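/- For every a ∈ ℝ^7 with all coordinates nonzero, P(|a_1ε_1 + ... + a_7ε_7| > ‖a‖) ≥ 7/32, and equality holds for a = (2,2,2,1,1,1,1); hence G_7' = 7/32. -/

import Mathlib

open Finset
open scoped Classical

/-- sign of a Boolean: `true ↦ 1`, `false ↦ -1` (a Rademacher value). -/
noncomputable def rsign (b : Bool) : ℝ := if b then 1 else -1

/-- Probability of an event under the uniform distribution on `{-1,1}^n`. -/
noncomputable def prob (n : ℕ) (E : (Fin n → Bool) → Prop) : ℝ :=
  ((Finset.univ.filter fun s => E s).card : ℝ) / 2 ^ n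

/-! ### Outline

By symmetry we may assume the weights are positive and decreasing.  The set `U` of sign vectors
with signed sum exceeding the norm is then closed upwards in the dominance order.  If `U` had at
most 13 elements it would be contained in one of 15 up-closed sets of size 13; for each of these,
the inequalities `S a s ≤ N` over the maximal vectors `s` outside the set contradict
`N ^ 2 = ∑ a i ^ 2`, by an explicit combination of products of nonnegative linear forms
(`case1`, ..., `case15`).  The names of the sign vectors spell out the signs, `p` for plus and
`m` for minus. -/

/-- The signed sum. -/
noncomputable def S (a : Fin 7 → ℝ) (s : Fin 7 → Bool) : ℝ := ∑ i, a i * rsign (s i)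

/-- Weights sorted in decreasing order and positive, together with their norm. -/
structure Ctx (a : Fin 7 → ℝ) (N : ℝ) : Prop where
  d1 : 0 ≤ a 0 - a 1
  d2 : 0 ≤ a 1 - a 2
  d3 : 0 ≤ a 2 - a 3
  d4 : 0 ≤ a 3 - a 4
  d5 : 0 ≤ a 4 - a 5
  d6 : 0 ≤ a 5 - a 6
  d7 : 0 < a 6
  n0 : 0 ≤ N
  q : N ^ 2 = a 0 ^ 2 + a 1 ^ 2 + a 2 ^ 2 + a 3 ^ 2 + a 4 ^ 2 + a 5 ^ 2 + a 6 ^ 2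

theorem Ctx.c1 {a : Fin 7 → ℝ} {N : ℝ} (C : Ctx a N) : 0 ≤ N - a 0 := by
  refine sub_nonneg.2 (abs_le_of_sq_le_sq' ?_ C.n0).2
  have := C.q
  nlinarith [sq_nonneg (a 1), sq_nonneg (a 2), sq_nonneg (a 3), sq_nonneg (a 4), sq_nonneg (a 5),
    sq_nonneg (a 6)]

theorem Ctx.c4 {a : Fin 7 → ℝ} {N : ℝ} (C : Ctx a N) :
    0 ≤ 2 * N - (a 0 + a 1 + a 2 + a 3) := by
  refine sub_nonneg.2 (abs_le_of_sq_le_sq' ?_ (mul_nonneg zero_le_two C.n0)).2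
  have := C.q
  nlinarith [sq_nonneg (a 0 - a 1), sq_nonneg (a 0 - a 2), sq_nonneg (a 0 - a 3),
    sq_nonneg (a 1 - a 2), sq_nonneg (a 1 - a 3), sq_nonneg (a 2 - a 3), sq_nonneg (a 4),
    sq_nonneg (a 5), sq_nonneg (a 6)]

theorem Ctx.slack {a : Fin 7 → ℝ} {N : ℝ} (_ : Ctx a N) {s : Fin 7 → Bool} (h : S a s ≤ N) :
    0 ≤ N - (a 0 * rsign (s 0) + a 1 * rsign (s 1) + a 2 * rsign (s 2) + a 3 * rsign (s 3)
      + a 4 * rsign (s 4) + a 5 * rsign (s 5) + a 6 * rsign (s 6)) := by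
  rw [S, Fin.sum_univ_seven] at h
  exact sub_nonneg.2 h

@[simp] theorem rsign_true : rsign true = 1 := by simp [rsign]

@[simp] theorem rsign_false : rsign false = -1 := by simp [rsign]

/-- Nonnegative combinations of the gaps between consecutive weights are nonnegative. -/
theorem Ctx.cone {a : Fin 7 → ℝ} {N : ℝ} (C : Ctx a N) (k1 k2 k3 k4 k5 k6 k7 : ℝ)
    (hk : 0 ≤ k1 ∧ 0 ≤ k2 ∧ 0 ≤ k3 ∧ 0 ≤ k4 ∧ 0 ≤ k5 ∧ 0 ≤ k6 ∧ 0 ≤ k7 := by norm_num) :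
    0 ≤ k1 * (a 0 - a 1) + k2 * (a 1 - a 2) + k3 * (a 2 - a 3) + k4 * (a 3 - a 4)
      + k5 * (a 4 - a 5) + k6 * (a 5 - a 6) + k7 * a 6 := by
  obtain ⟨_, _, _, _, _, _, _⟩ := hk
  have := C.d1
  have := C.d2
  have := C.d3
  have := C.d4
  have := C.d5
  have := C.d6
  have := C.d7.le
  positivity

/-- Integer sign. -/
def sg (b : Bool) : ℤ := if b then 1 else -1

theorem sg_cast (b : Bool) : (sg b : ℝ) = rsign b := by cases b <;> simp [sg]

/-- Dominance order on sign vectors: comparison of all partial sums. -/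
def dom (t s : Fin 7 → Bool) : Bool :=
  decide (sg (s 0) ≤ sg (t 0)) &&
  decide (sg (s 0) + sg (s 1) ≤ sg (t 0) + sg (t 1)) &&
  decide (sg (s 0) + sg (s 1) + sg (s 2) ≤ sg (t 0) + sg (t 1) + sg (t 2)) &&
  decide (sg (s 0) + sg (s 1) + sg (s 2) + sg (s 3) ≤ sg (t 0) + sg (t 1) + sg (t 2) + sg (t 3)) &&
  decide (sg (s 0) + sg (s 1) + sg (s 2) + sg (s 3) + sg (s 4) ≤
    sg (t 0) + sg (t 1) + sg (t 2) + sg (t 3) + sg (t 4)) &&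
  decide (sg (s 0) + sg (s 1) + sg (s 2) + sg (s 3) + sg (s 4) + sg (s 5) ≤
    sg (t 0) + sg (t 1) + sg (t 2) + sg (t 3) + sg (t 4) + sg (t 5)) &&
  decide (sg (s 0) + sg (s 1) + sg (s 2) + sg (s 3) + sg (s 4) + sg (s 5) + sg (s 6) ≤
    sg (t 0) + sg (t 1) + sg (t 2) + sg (t 3) + sg (t 4) + sg (t 5) + sg (t 6))

theorem Ctx.mono {a : Fin 7 → ℝ} {N : ℝ} (C : Ctx a N) {s t : Fin 7 → Bool}
    (h : dom t s = true) : S a s ≤ S a t := by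
  simp only [dom, Bool.and_eq_true, decide_eq_true_eq] at h
  obtain ⟨⟨⟨⟨⟨⟨h1, h2⟩, h3⟩, h4⟩, h5⟩, h6⟩, h7⟩ := h
  rify at h1 h2 h3 h4 h5 h6 h7
  simp only [sg_cast] at h1 h2 h3 h4 h5 h6 h7
  rw [S, S, Fin.sum_univ_seven, Fin.sum_univ_seven]
  linarith [mul_nonneg C.d1 (sub_nonneg.2 h1), mul_nonneg C.d2 (sub_nonneg.2 h2),
    mul_nonneg C.d3 (sub_nonneg.2 h3), mul_nonneg C.d4 (sub_nonneg.2 h4),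
    mul_nonneg C.d5 (sub_nonneg.2 h5), mul_nonneg C.d6 (sub_nonneg.2 h6),
    mul_nonneg C.d7.le (sub_nonneg.2 h7)]

theorem leaf {a : Fin 7 → ℝ} {N : ℝ} (C : Ctx a N)
    (hU : (univ.filter fun s => N < S a s).card < 14) (L : List (Fin 7 → Bool))
    (hL : ∀ s ∈ L, N < S a s)
    (hc : 14 ≤ (univ.filter fun t : Fin 7 → Bool => L.any (fun s => dom t s) = true).card) :
    False := by
  refine absurd (hc.trans (card_le_card ?_)) (not_le.2 hU)
  intro t ht
  simp only [mem_filter, mem_univ, true_and, List.any_eq_true] at ht ⊢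
  obtain ⟨s, hs, hd⟩ := ht
  exact (hL s hs).trans_le (C.mono hd)

def wppppmmp : Fin 7 → Bool := ![true, true, true, true, false, false, true]
def wppppmmm : Fin 7 → Bool := ![true, true, true, true, false, false, false]
def wpppmpmp : Fin 7 → Bool := ![true, true, true, false, true, false, true]
def wpppmpmm : Fin 7 → Bool := ![true, true, true, false, true, false, false]
def wpppmmpp : Fin 7 → Bool := ![true, true, true, false, false, true, true]
def wpppmmpm : Fin 7 → Bool := ![true, true, true, false, false, true, false]
def wppmpppp : Fin 7 → Bool := ![true, true, false, true, true, true, true]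
def wppmpppm : Fin 7 → Bool := ![true, true, false, true, true, true, false]
def wppmppmp : Fin 7 → Bool := ![true, true, false, true, true, false, true]
def wpmppppp : Fin 7 → Bool := ![true, false, true, true, true, true, true]
def wpmppppm : Fin 7 → Bool := ![true, false, true, true, true, true, false]
def wmpppppp : Fin 7 → Bool := ![false, true, true, true, true, true, true]
def wmpppppm : Fin 7 → Bool := ![false, true, true, true, true, true, false]

theorem Ctx.wppppmmp {a : Fin 7 → ℝ} {N : ℝ} (C : Ctx a N) (h : S a _root_.wppppmmp ≤ N) :
    0 ≤ N - (a 0 + a 1 + a 2 + a 3 - a 4 - a 5 + a 6) := by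
  simpa [_root_.wppppmmp, sub_eq_add_neg] using C.slack h

theorem Ctx.wppppmmm {a : Fin 7 → ℝ} {N : ℝ} (C : Ctx a N) (h : S a _root_.wppppmmm ≤ N) :
    0 ≤ N - (a 0 + a 1 + a 2 + a 3 - a 4 - a 5 - a 6) := by
  simpa [_root_.wppppmmm, sub_eq_add_neg] using C.slack h

theorem Ctx.wpppmpmp {a : Fin 7 → ℝ} {N : ℝ} (C : Ctx a N) (h : S a _root_.wpppmpmp ≤ N) :
    0 ≤ N - (a 0 + a 1 + a 2 - a 3 + a 4 - a 5 + a 6) := by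
  simpa [_root_.wpppmpmp, sub_eq_add_neg] using C.slack h

theorem Ctx.wpppmpmm {a : Fin 7 → ℝ} {N : ℝ} (C : Ctx a N) (h : S a _root_.wpppmpmm ≤ N) :
    0 ≤ N - (a 0 + a 1 + a 2 - a 3 + a 4 - a 5 - a 6) := by
  simpa [_root_.wpppmpmm, sub_eq_add_neg] using C.slack h

theorem Ctx.wpppmmpp {a : Fin 7 → ℝ} {N : ℝ} (C : Ctx a N) (h : S a _root_.wpppmmpp ≤ N) :
    0 ≤ N - (a 0 + a 1 + a 2 - a 3 - a 4 + a 5 + a 6) := by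
  simpa [_root_.wpppmmpp, sub_eq_add_neg] using C.slack h

theorem Ctx.wpppmmpm {a : Fin 7 → ℝ} {N : ℝ} (C : Ctx a N) (h : S a _root_.wpppmmpm ≤ N) :
    0 ≤ N - (a 0 + a 1 + a 2 - a 3 - a 4 + a 5 - a 6) := by
  simpa [_root_.wpppmmpm, sub_eq_add_neg] using C.slack h

theorem Ctx.wppmpppp {a : Fin 7 → ℝ} {N : ℝ} (C : Ctx a N) (h : S a _root_.wppmpppp ≤ N) :
    0 ≤ N - (a 0 + a 1 - a 2 + a 3 + a 4 + a 5 + a 6) := by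
  simpa [_root_.wppmpppp, sub_eq_add_neg] using C.slack h

theorem Ctx.wppmpppm {a : Fin 7 → ℝ} {N : ℝ} (C : Ctx a N) (h : S a _root_.wppmpppm ≤ N) :
    0 ≤ N - (a 0 + a 1 - a 2 + a 3 + a 4 + a 5 - a 6) := by
  simpa [_root_.wppmpppm, sub_eq_add_neg] using C.slack h

theorem Ctx.wppmppmp {a : Fin 7 → ℝ} {N : ℝ} (C : Ctx a N) (h : S a _root_.wppmppmp ≤ N) :
    0 ≤ N - (a 0 + a 1 - a 2 + a 3 + a 4 - a 5 + a 6) := by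
  simpa [_root_.wppmppmp, sub_eq_add_neg] using C.slack h

theorem Ctx.wpmppppp {a : Fin 7 → ℝ} {N : ℝ} (C : Ctx a N) (h : S a _root_.wpmppppp ≤ N) :
    0 ≤ N - (a 0 - a 1 + a 2 + a 3 + a 4 + a 5 + a 6) := by
  simpa [_root_.wpmppppp, sub_eq_add_neg] using C.slack h

theorem Ctx.wpmppppm {a : Fin 7 → ℝ} {N : ℝ} (C : Ctx a N) (h : S a _root_.wpmppppm ≤ N) :
    0 ≤ N - (a 0 - a 1 + a 2 + a 3 + a 4 + a 5 - a 6) := by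
  simpa [_root_.wpmppppm, sub_eq_add_neg] using C.slack h

theorem Ctx.wmpppppp {a : Fin 7 → ℝ} {N : ℝ} (C : Ctx a N) (h : S a _root_.wmpppppp ≤ N) :
    0 ≤ N - (-a 0 + a 1 + a 2 + a 3 + a 4 + a 5 + a 6) := by
  simpa [_root_.wmpppppp, sub_eq_add_neg] using C.slack h

theorem Ctx.wmpppppm {a : Fin 7 → ℝ} {N : ℝ} (C : Ctx a N) (h : S a _root_.wmpppppm ≤ N) :
    0 ≤ N - (-a 0 + a 1 + a 2 + a 3 + a 4 + a 5 - a 6) := by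
  simpa [_root_.wmpppppm, sub_eq_add_neg] using C.slack h

theorem case1 {a : Fin 7 → ℝ} {N : ℝ} (C : Ctx a N)
    (h1 : S a wppppmmp ≤ N)
    (h2 : S a wmpppppm ≤ N) : False := by
  replace h1 := C.wppppmmp h1
  replace h2 := C.wmpppppm h2
  linarith [C.q,
    mul_nonneg h1 h1, mul_pos C.d7 C.d7,
    mul_nonneg h1 (C.cone 2 3 6 5 6 3 4), mul_nonneg h2 (C.cone 0 0 0 0 0 1 2),
    mul_nonneg C.n0 (C.cone 0 1 0 3 0 0 0), mul_nonneg C.d1 (C.cone 0 1 4 3 4 0 0),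
    mul_nonneg C.d2 (C.cone 0 0 5 2 5 0 1), mul_nonneg C.d3 (C.cone 0 0 6 9 12 4 8),
    mul_nonneg C.d4 (C.cone 0 0 0 0 7 0 3), mul_nonneg C.d5 (C.cone 0 0 0 0 4 2 8),
    mul_nonneg C.d6 (C.cone 0 0 0 0 0 0 4)]

theorem case2 {a : Fin 7 → ℝ} {N : ℝ} (C : Ctx a N)
    (h1 : S a wppppmmm ≤ N)
    (h2 : S a wpppmpmp ≤ N)
    (h3 : S a wpmppppm ≤ N) : False := by
  replace h1 := C.wppppmmm h1
  replace h2 := C.wpppmpmp h2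
  replace h3 := C.wpmppppm h3
  linarith [C.q,
    mul_nonneg h2 h2, mul_pos C.d7 C.d7,
    mul_nonneg h1 (C.cone 8 8 15 0 16 0 0), mul_nonneg h2 (C.cone 0 7 0 0 8 7 24),
    mul_nonneg h3 (C.cone 0 1 3 16 0 9 0), mul_nonneg C.n0 (C.cone 0 0 6 0 0 0 0),
    mul_nonneg C.d1 (C.cone 0 8 10 24 16 8 0), mul_nonneg C.d2 (C.cone 0 6 12 0 32 0 16),
    mul_nonneg C.d3 (C.cone 0 0 0 10 30 0 0), mul_nonneg C.d4 (C.cone 0 0 0 0 48 32 16),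
    mul_nonneg C.d5 (C.cone 0 0 0 0 16 8 0), mul_nonneg C.d6 (C.cone 0 0 0 0 0 10 0)]

theorem case3 {a : Fin 7 → ℝ} {N : ℝ} (C : Ctx a N)
    (h1 : S a wppppmmm ≤ N)
    (h2 : S a wpppmpmp ≤ N)
    (h3 : S a wmpppppp ≤ N) : False := by
  replace h1 := C.wppppmmm h1
  replace h2 := C.wpppmpmp h2
  replace h3 := C.wmpppppp h3
  linarith [C.q,
    mul_pos C.d7 C.d7, mul_nonneg h1 h2,
    mul_nonneg h1 (C.cone 0 1 10 0 8 6 0), mul_nonneg h2 (C.cone 4 5 0 6 4 0 4),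
    mul_nonneg h3 (C.cone 0 0 2 0 0 2 4), mul_nonneg C.n0 (C.cone 0 2 0 0 0 0 0),
    mul_nonneg C.d1 (C.cone 0 2 4 1 8 0 0), mul_nonneg C.d2 (C.cone 0 0 6 0 10 0 0),
    mul_nonneg C.d3 (C.cone 0 0 8 23 24 12 0), mul_nonneg C.d4 (C.cone 0 0 0 0 18 12 2),
    mul_nonneg C.d5 (C.cone 0 0 0 0 8 4 0), mul_nonneg C.c4 (C.cone 0 0 0 3 0 0 0)]

theorem case4 {a : Fin 7 → ℝ} {N : ℝ} (C : Ctx a N)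
    (h1 : S a wppppmmm ≤ N)
    (h2 : S a wpppmmpp ≤ N)
    (h3 : S a wppmpppm ≤ N) : False := by
  replace h1 := C.wppppmmm h1
  replace h2 := C.wpppmmpp h2
  replace h3 := C.wppmpppm h3
  linarith [C.q,
    mul_pos C.d7 C.d7, mul_nonneg h1 h3,
    mul_nonneg h1 (C.cone 2 4 4 2 0 2 0), mul_nonneg h2 (C.cone 0 0 0 0 0 3 4),
    mul_nonneg h3 (C.cone 0 0 0 4 6 1 0), mul_nonneg C.d1 (C.cone 0 2 4 6 4 2 0),
    mul_nonneg C.d2 (C.cone 0 2 8 12 8 4 0), mul_nonneg C.d3 (C.cone 0 0 6 10 0 4 0),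
    mul_nonneg C.d4 (C.cone 0 0 0 4 4 8 0), mul_nonneg C.d5 (C.cone 0 0 0 0 4 8 0)]

theorem case5 {a : Fin 7 → ℝ} {N : ℝ} (C : Ctx a N)
    (h1 : S a wppppmmm ≤ N)
    (h2 : S a wpppmmpp ≤ N)
    (h3 : S a wppmppmp ≤ N)
    (h4 : S a wpmppppm ≤ N)
    (h5 : S a wmpppppp ≤ N) : False := by
  replace h1 := C.wppppmmm h1
  replace h2 := C.wpppmmpp h2
  replace h3 := C.wppmppmp h3
  replace h4 := C.wpmppppm h4
  replace h5 := C.wmpppppp h5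
  linarith [C.q,
    mul_nonneg h2 h3, mul_nonneg C.n0 h2,
    mul_nonneg h1 h4, mul_pos C.d7 C.d7,
    mul_nonneg h1 (C.cone 6 6 2 11 0 2 0), mul_nonneg h2 (C.cone 0 0 0 0 2 0 16),
    mul_nonneg h3 (C.cone 0 0 0 0 4 0 0), mul_nonneg h4 (C.cone 0 4 12 0 0 12 0),
    mul_nonneg h5 (C.cone 0 0 0 3 6 0 0), mul_nonneg C.d1 (C.cone 0 8 16 14 0 8 4),
    mul_nonneg C.d2 (C.cone 0 0 0 26 12 0 16), mul_nonneg C.d3 (C.cone 0 0 0 26 12 24 40),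
    mul_nonneg C.d4 (C.cone 0 0 0 22 8 6 0), mul_nonneg C.d5 (C.cone 0 0 0 0 0 12 0),
    mul_nonneg C.d6 (C.cone 0 0 0 0 0 16 0)]

theorem case6 {a : Fin 7 → ℝ} {N : ℝ} (C : Ctx a N)
    (h1 : S a wppppmmm ≤ N)
    (h2 : S a wpppmmpp ≤ N)
    (h3 : S a wpmppppp ≤ N) : False := by
  replace h1 := C.wppppmmm h1
  replace h2 := C.wpppmmpp h2
  replace h3 := C.wpmppppp h3
  linarith [C.q,
    mul_pos C.d7 C.d7, mul_nonneg h2 C.c4,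
    mul_nonneg C.n0 h3, mul_nonneg h1 (C.cone 5 6 11 12 6 16 0),
    mul_nonneg h2 (C.cone 0 0 0 0 6 0 14), mul_nonneg h3 (C.cone 0 0 0 0 0 0 6),
    mul_nonneg C.d1 (C.cone 0 4 12 18 14 12 10), mul_nonneg C.d2 (C.cone 0 0 12 20 16 16 4),
    mul_nonneg C.d3 (C.cone 0 0 12 38 30 28 14), mul_nonneg C.d4 (C.cone 0 0 0 24 28 40 0),
    mul_nonneg C.d5 (C.cone 0 0 0 0 0 20 0)]

theorem case7 {a : Fin 7 → ℝ} {N : ℝ} (C : Ctx a N)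
    (h1 : S a wppppmmm ≤ N)
    (h2 : S a wppmpppm ≤ N)
    (h3 : S a wmpppppp ≤ N) : False := by
  replace h1 := C.wppppmmm h1
  replace h2 := C.wppmpppm h2
  replace h3 := C.wmpppppp h3
  linarith [C.q,
    mul_nonneg h1 h3, mul_pos C.d7 C.d7,
    mul_nonneg h1 h2, mul_nonneg h1 (C.cone 2 6 2 7 0 10 0),
    mul_nonneg h2 (C.cone 0 0 2 0 12 2 10), mul_nonneg h3 (C.cone 0 0 4 5 0 0 0),
    mul_nonneg C.d1 (C.cone 0 4 0 2 8 4 0), mul_nonneg C.d2 (C.cone 0 4 8 14 16 8 0),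
    mul_nonneg C.d3 (C.cone 0 0 0 14 0 20 0), mul_nonneg C.d4 (C.cone 0 0 0 14 8 22 0),
    mul_nonneg C.d5 (C.cone 0 0 0 0 8 28 16), mul_nonneg C.d6 (C.cone 0 0 0 0 0 0 8)]

theorem case8 {a : Fin 7 → ℝ} {N : ℝ} (C : Ctx a N)
    (h1 : S a wppppmmm ≤ N)
    (h2 : S a wppmppmp ≤ N)
    (h3 : S a wpmppppp ≤ N) : False := by
  replace h1 := C.wppppmmm h1
  replace h2 := C.wppmppmp h2
  replace h3 := C.wpmppppp h3
  linarith [C.q,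
    mul_pos C.d7 C.d7, mul_nonneg h3 C.c4,
    mul_nonneg h1 (C.cone 3 2 2 4 10 10 0), mul_nonneg h2 (C.cone 0 0 0 4 0 0 8),
    mul_nonneg h3 (C.cone 0 0 3 0 0 2 6), mul_nonneg C.d1 (C.cone 0 2 6 10 8 6 4),
    mul_nonneg C.d2 (C.cone 0 0 0 12 12 8 0), mul_nonneg C.d3 (C.cone 0 0 0 8 20 20 0),
    mul_nonneg C.d4 (C.cone 0 0 0 8 28 20 0), mul_nonneg C.d5 (C.cone 0 0 0 0 8 8 0)]

theorem case9 {a : Fin 7 → ℝ} {N : ℝ} (C : Ctx a N)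
    (h1 : S a wpppmpmp ≤ N)
    (h2 : S a wppmpppm ≤ N) : False := by
  replace h1 := C.wpppmpmp h1
  replace h2 := C.wppmpppm h2
  linarith [C.q,
    mul_pos C.d7 C.d7, mul_nonneg h1 C.c1,
    mul_nonneg h1 (C.cone 1 1 0 0 0 0 0), mul_nonneg h2 (C.cone 1 0 0 3 0 3 4),
    mul_nonneg C.d1 (C.cone 0 1 0 2 2 4 4), mul_nonneg C.d2 (C.cone 0 0 1 4 2 4 6),
    mul_nonneg C.d3 (C.cone 0 0 0 0 2 0 0), mul_nonneg C.d4 (C.cone 0 0 0 0 4 6 4),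
    mul_nonneg C.d5 (C.cone 0 0 0 0 0 2 4), mul_nonneg C.d6 (C.cone 0 0 0 0 0 4 8),
    mul_nonneg C.c4 (C.cone 0 1 2 0 2 0 0)]

theorem case10 {a : Fin 7 → ℝ} {N : ℝ} (C : Ctx a N)
    (h1 : S a wpppmpmp ≤ N)
    (h2 : S a wpmppppm ≤ N)
    (h3 : S a wmpppppp ≤ N) : False := by
  replace h1 := C.wpppmpmp h1
  replace h2 := C.wpmppppm h2
  replace h3 := C.wmpppppp h3
  linarith [C.q,
    mul_nonneg C.n0 h1, mul_pos C.d7 C.d7,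
    mul_nonneg h1 (C.cone 2 2 0 4 6 2 6), mul_nonneg h2 (C.cone 0 0 0 0 0 2 0),
    mul_nonneg C.n0 (C.cone 0 2 0 0 0 0 0), mul_nonneg C.d1 (C.cone 0 2 5 4 8 4 8),
    mul_nonneg C.d2 (C.cone 0 0 4 4 10 0 10), mul_nonneg C.d3 (C.cone 0 0 3 12 18 8 18),
    mul_nonneg C.d4 (C.cone 0 0 0 0 8 0 8), mul_nonneg C.d5 (C.cone 0 0 0 0 8 4 16),
    mul_nonneg C.c4 (C.cone 0 0 3 0 0 0 0)]

theorem case11 {a : Fin 7 → ℝ} {N : ℝ} (C : Ctx a N)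
    (h1 : S a wpppmpmm ≤ N)
    (h2 : S a wpppmmpp ≤ N)
    (h3 : S a wppmpppm ≤ N)
    (h4 : S a wmpppppp ≤ N) : False := by
  replace h1 := C.wpppmpmm h1
  replace h2 := C.wpppmmpp h2
  replace h3 := C.wppmpppm h3
  replace h4 := C.wmpppppp h4
  linarith [C.q,
    mul_nonneg h1 C.c4, mul_nonneg h2 C.c4,
    mul_pos C.d7 C.d7, mul_nonneg h1 (C.cone 0 0 45 20 0 0 0),
    mul_nonneg h2 (C.cone 0 16 0 0 0 30 46), mul_nonneg h3 (C.cone 15 14 0 20 18 10 0),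
    mul_nonneg h4 (C.cone 0 0 0 0 16 0 0), mul_nonneg C.d1 (C.cone 0 20 10 20 0 50 38),
    mul_nonneg C.d2 (C.cone 0 20 52 40 0 68 76), mul_nonneg C.d3 (C.cone 0 0 60 20 28 40 24),
    mul_nonneg C.d4 (C.cone 0 0 0 0 40 40 0), mul_nonneg C.d5 (C.cone 0 0 0 0 24 28 0)]

theorem case12 {a : Fin 7 → ℝ} {N : ℝ} (C : Ctx a N)
    (h1 : S a wpppmpmm ≤ N)
    (h2 : S a wpppmmpp ≤ N)
    (h3 : S a wppmppmp ≤ N)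
    (h4 : S a wpmppppp ≤ N) : False := by
  replace h1 := C.wpppmpmm h1
  replace h2 := C.wpppmmpp h2
  replace h3 := C.wppmppmp h3
  replace h4 := C.wpmppppp h4
  linarith [C.q,
    mul_pos C.d7 C.d7, mul_nonneg h1 h3,
    mul_nonneg h1 (C.cone 2 4 1 2 2 1 0), mul_nonneg h2 (C.cone 0 0 0 2 2 2 4),
    mul_nonneg h4 (C.cone 0 0 3 0 2 1 0), mul_nonneg C.d1 (C.cone 0 2 4 2 4 2 0),
    mul_nonneg C.d2 (C.cone 0 2 2 4 4 2 0), mul_nonneg C.d3 (C.cone 0 0 0 6 8 10 12),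
    mul_nonneg C.d5 (C.cone 0 0 0 0 0 2 0)]

theorem case13 {a : Fin 7 → ℝ} {N : ℝ} (C : Ctx a N)
    (h1 : S a wpppmpmm ≤ N)
    (h2 : S a wppmpppm ≤ N)
    (h3 : S a wpmppppp ≤ N) : False := by
  replace h1 := C.wpppmpmm h1
  replace h2 := C.wppmpppm h2
  replace h3 := C.wpmppppp h3
  linarith [C.q,
    mul_nonneg h3 C.c4, mul_pos C.d7 C.d7,
    mul_nonneg h1 (C.cone 3 2 2 2 10 10 0), mul_nonneg h2 (C.cone 0 0 0 6 0 2 8),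
    mul_nonneg h3 (C.cone 0 0 3 0 0 0 6), mul_nonneg C.d1 (C.cone 0 2 6 4 8 6 4),
    mul_nonneg C.d2 (C.cone 0 0 0 8 12 12 0), mul_nonneg C.d3 (C.cone 0 0 0 0 20 20 0),
    mul_nonneg C.d4 (C.cone 0 0 0 0 8 12 4), mul_nonneg C.d5 (C.cone 0 0 0 0 8 8 0),
    mul_nonneg C.d6 (C.cone 0 0 0 0 0 0 12)]

theorem case14 {a : Fin 7 → ℝ} {N : ℝ} (C : Ctx a N)
    (h1 : S a wpppmmpp ≤ N)
    (h2 : S a wppmpppm ≤ N)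
    (h3 : S a wpmppppp ≤ N) : False := by
  replace h1 := C.wpppmmpp h1
  replace h2 := C.wppmpppm h2
  replace h3 := C.wpmppppp h3
  linarith [C.q,
    mul_nonneg h1 h1, mul_pos C.d7 C.d7,
    mul_nonneg h1 (C.cone 2 2 4 2 0 0 6), mul_nonneg h2 (C.cone 0 2 2 2 0 4 0),
    mul_nonneg h3 (C.cone 0 0 0 0 2 0 0), mul_nonneg C.d1 (C.cone 0 2 4 2 0 2 4),
    mul_nonneg C.d2 (C.cone 0 2 4 4 0 8 8), mul_nonneg C.d3 (C.cone 0 0 2 2 0 2 12),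
    mul_nonneg C.d4 (C.cone 0 0 0 0 0 4 4), mul_nonneg C.d5 (C.cone 0 0 0 0 0 6 0),
    mul_nonneg C.d6 (C.cone 0 0 0 0 0 6 0)]

theorem case15 {a : Fin 7 → ℝ} {N : ℝ} (C : Ctx a N)
    (h1 : S a wpppmmpm ≤ N)
    (h2 : S a wppmpppp ≤ N) : False := by
  replace h1 := C.wpppmmpm h1
  replace h2 := C.wppmpppp h2
  linarith [C.q,
    mul_nonneg h1 h1, mul_nonneg h2 C.c4,
    mul_pos C.d7 C.d7, mul_nonneg h1 (C.cone 7 0 12 4 4 16 0),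
    mul_nonneg h2 (C.cone 0 14 5 12 10 4 18), mul_nonneg C.d1 (C.cone 0 8 14 8 2 10 4),
    mul_nonneg C.d2 (C.cone 0 8 0 16 32 48 64), mul_nonneg C.d3 (C.cone 0 0 8 0 0 32 0),
    mul_nonneg C.d4 (C.cone 0 0 0 0 8 24 32), mul_nonneg C.d5 (C.cone 0 0 0 0 0 0 32),
    mul_nonneg C.d6 (C.cone 0 0 0 0 0 0 16)]

/-- The one-sided count for sorted positive weights. -/
theorem sorted_count {a : Fin 7 → ℝ} {N : ℝ} (C : Ctx a N) :
    14 ≤ (univ.filter fun s => N < S a s).card := by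
  by_contra hU
  rw [not_le] at hU
  rcases le_or_gt (S a wpppmmpp) N with opppmmpp | ipppmmpp
  · rcases le_or_gt (S a wppmpppm) N with oppmpppm | ippmpppm
    · rcases le_or_gt (S a wppppmmm) N with oppppmmm | ippppmmm
      · exact case4 C oppppmmm opppmmpp oppmpppm
      · rcases le_or_gt (S a wpppmpmm) N with opppmpmm | ipppmpmm
        · rcases le_or_gt (S a wpmppppp) N with opmppppp | ipmppppp
          · exact case13 C opppmpmm oppmpppm opmppppp
          · rcases le_or_gt (S a wpppmpmp) N with opppmpmp | ipppmpmp
            · exact case9 C opppmpmp oppmpppm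
            · rcases le_or_gt (S a wmpppppp) N with ompppppp | impppppp
              · exact case11 C opppmpmm opppmmpp oppmpppm ompppppp
              · exact leaf C hU [wppppmmm, wpppmpmp, wmpppppp] (by simp [ippppmmm, ipppmpmp, impppppp]) (by decide +kernel)
        · rcases le_or_gt (S a wpppmmpm) N with opppmmpm | ipppmmpm
          · rcases le_or_gt (S a wpmppppp) N with opmppppp | ipmppppp
            · exact case14 C opppmmpp oppmpppm opmppppp
            · exact leaf C hU [wpppmpmm, wpmppppp] (by simp [ipppmpmm, ipmppppp]) (by decide +kernel)
          · exact leaf C hU [wpppmmpm] (by simp [ipppmmpm]) (by decide +kernel)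
    · rcases le_or_gt (S a wppppmmm) N with oppppmmm | ippppmmm
      · rcases le_or_gt (S a wppmppmp) N with oppmppmp | ippmppmp
        · rcases le_or_gt (S a wpmppppm) N with opmppppm | ipmppppm
          · rcases le_or_gt (S a wpppmpmp) N with opppmpmp | ipppmpmp
            · exact case2 C oppppmmm opppmpmp opmppppm
            · rcases le_or_gt (S a wpmppppp) N with opmppppp | ipmppppp
              · exact case6 C oppppmmm opppmmpp opmppppp
              · rcases le_or_gt (S a wmpppppp) N with ompppppp | impppppp
                · exact case5 C oppppmmm opppmmpp oppmppmp opmppppm ompppppp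
                · exact leaf C hU [wppmpppm, wpppmpmp, wmpppppp] (by simp [ippmpppm, ipppmpmp, impppppp]) (by decide +kernel)
          · rcases le_or_gt (S a wmpppppm) N with ompppppm | impppppm
            · rcases le_or_gt (S a wppppmmp) N with oppppmmp | ippppmmp
              · exact case1 C oppppmmp ompppppm
              · rcases le_or_gt (S a wpppmpmp) N with opppmpmp | ipppmpmp
                · rcases le_or_gt (S a wmpppppp) N with ompppppp | impppppp
                  · exact case3 C oppppmmm opppmpmp ompppppp
                  · exact leaf C hU [wpmppppm, wppppmmp, wmpppppp] (by simp [ipmppppm, ippppmmp, impppppp]) (by decide +kernel)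
                · exact leaf C hU [wpmppppm, wpppmpmp] (by simp [ipmppppm, ipppmpmp]) (by decide +kernel)
            · exact leaf C hU [wmpppppm] (by simp [impppppm]) (by decide +kernel)
        · rcases le_or_gt (S a wpmppppp) N with opmppppp | ipmppppp
          · exact case6 C oppppmmm opppmmpp opmppppp
          · exact leaf C hU [wppmppmp, wpmppppp] (by simp [ippmppmp, ipmppppp]) (by decide +kernel)
      · rcases le_or_gt (S a wppmppmp) N with oppmppmp | ippmppmp
        · rcases le_or_gt (S a wpppmpmm) N with opppmpmm | ipppmpmm
          · rcases le_or_gt (S a wpmppppp) N with opmppppp | ipmppppp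
            · exact case12 C opppmpmm opppmmpp oppmppmp opmppppp
            · rcases le_or_gt (S a wpmppppm) N with opmppppm | ipmppppm
              · rcases le_or_gt (S a wpppmpmp) N with opppmpmp | ipppmpmp
                · rcases le_or_gt (S a wmpppppp) N with ompppppp | impppppp
                  · exact case10 C opppmpmp opmppppm ompppppp
                  · exact leaf C hU [wppmpppm, wppppmmm, wmpppppp] (by simp [ippmpppm, ippppmmm, impppppp]) (by decide +kernel)
                · exact leaf C hU [wppmpppm, wppppmmm, wpmppppp, wpppmpmp] (by simp [ippmpppm, ippppmmm, ipmppppp, ipppmpmp]) (by decide +kernel)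
              · exact leaf C hU [wppppmmm, wpmppppm] (by simp [ippppmmm, ipmppppm]) (by decide +kernel)
          · exact leaf C hU [wppmpppm, wpppmpmm] (by simp [ippmpppm, ipppmpmm]) (by decide +kernel)
        · exact leaf C hU [wppppmmm, wppmppmp] (by simp [ippppmmm, ippmppmp]) (by decide +kernel)
  · rcases le_or_gt (S a wppmpppm) N with oppmpppm | ippmpppm
    · rcases le_or_gt (S a wppppmmm) N with oppppmmm | ippppmmm
      · rcases le_or_gt (S a wpmppppp) N with opmppppp | ipmppppp
        · rcases le_or_gt (S a wppmppmp) N with oppmppmp | ippmppmp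
          · exact case8 C oppppmmm oppmppmp opmppppp
          · exact leaf C hU [wpppmmpp, wppmppmp] (by simp [ipppmmpp, ippmppmp]) (by decide +kernel)
        · rcases le_or_gt (S a wmpppppp) N with ompppppp | impppppp
          · exact case7 C oppppmmm oppmpppm ompppppp
          · exact leaf C hU [wpppmmpp, wmpppppp] (by simp [ipppmmpp, impppppp]) (by decide +kernel)
      · rcases le_or_gt (S a wpppmmpm) N with opppmmpm | ipppmmpm
        · rcases le_or_gt (S a wpppmpmm) N with opppmpmm | ipppmpmm
          · rcases le_or_gt (S a wpmppppp) N with opmppppp | ipmppppp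
            · exact case13 C opppmpmm oppmpppm opmppppp
            · exact leaf C hU [wpppmmpp, wppppmmm, wpmppppp] (by simp [ipppmmpp, ippppmmm, ipmppppp]) (by decide +kernel)
          · rcases le_or_gt (S a wppmpppp) N with oppmpppp | ippmpppp
            · exact case15 C opppmmpm oppmpppp
            · exact leaf C hU [wpppmmpp, wpppmpmm, wppmpppp] (by simp [ipppmmpp, ipppmpmm, ippmpppp]) (by decide +kernel)
        · exact leaf C hU [wpppmmpm] (by simp [ipppmmpm]) (by decide +kernel)
    · rcases le_or_gt (S a wppmppmp) N with oppmppmp | ippmppmp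
      · rcases le_or_gt (S a wppppmmm) N with oppppmmm | ippppmmm
        · rcases le_or_gt (S a wpmppppp) N with opmppppp | ipmppppp
          · exact case8 C oppppmmm oppmppmp opmppppp
          · exact leaf C hU [wpppmmpp, wppmpppm, wpmppppp] (by simp [ipppmmpp, ippmpppm, ipmppppp]) (by decide +kernel)
        · exact leaf C hU [wpppmmpp, wppmpppm, wppppmmm] (by simp [ipppmmpp, ippmpppm, ippppmmm]) (by decide +kernel)
      · exact leaf C hU [wpppmmpp, wppmppmp] (by simp [ipppmmpp, ippmppmp]) (by decide +kernel)

theorem S_neg (a : Fin 7 → ℝ) (s : Fin 7 → Bool) : S a (fun i => !s i) = -S a s := by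
  rw [S, S, ← Finset.sum_neg_distrib]
  refine Finset.sum_congr rfl fun i _ => ?_
  cases s i <;> simp

/-- The one-sided count for arbitrary nonzero weights. -/
theorem count_one (a : Fin 7 → ℝ) (ha : ∀ i, a i ≠ 0) :
    14 ≤ (univ.filter fun s => Real.sqrt (∑ i, (a i) ^ 2) < S a s).card := by
  set σ : Equiv.Perm (Fin 7) := Tuple.sort (fun i => -|a i|) with hσ
  have hm : ∀ i j, i ≤ j → |a (σ j)| ≤ |a (σ i)| := fun i j hij => by
    have := Tuple.monotone_sort (fun i => -|a i|) hij
    simpa using this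
  set N := Real.sqrt (∑ i, (a i) ^ 2) with hN
  have hs : ∑ i, |a (σ i)| ^ 2 = ∑ i, (a i) ^ 2 := by
    rw [Equiv.sum_comp σ (fun i => |a i| ^ 2)]
    simp
  have C : Ctx (fun i => |a (σ i)|) N :=
    { d1 := sub_nonneg.2 (hm 0 1 (by decide))
      d2 := sub_nonneg.2 (hm 1 2 (by decide))
      d3 := sub_nonneg.2 (hm 2 3 (by decide))
      d4 := sub_nonneg.2 (hm 3 4 (by decide))
      d5 := sub_nonneg.2 (hm 4 5 (by decide))
      d6 := sub_nonneg.2 (hm 5 6 (by decide))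
      d7 := abs_pos.2 (ha _)
      n0 := Real.sqrt_nonneg _
      q := by
        rw [hN, Real.sq_sqrt (Finset.sum_nonneg fun i _ => sq_nonneg _), ← hs,
          Fin.sum_univ_seven] }
  refine (sorted_count C).trans ?_
  refine Finset.card_le_card_of_injOn
    (fun s i => if 0 < a i then s (σ.symm i) else !s (σ.symm i)) ?_ ?_
  · intro s h
    simp only [coe_filter, mem_univ, true_and, Set.mem_ofPred_eq] at h ⊢
    refine h.trans_eq ?_
    rw [S, S, ← Equiv.sum_comp σ (fun i => a i * rsign _)]
    refine Finset.sum_congr rfl fun i _ => ?_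
    rcases lt_or_gt_of_ne (ha (σ i)) with h0 | h0
    · cases hb : s i <;> simp [abs_of_neg h0, not_lt.2 h0.le, hb]
    · cases hb : s i <;> simp [abs_of_pos h0, h0, hb]
  · intro s _ t _ h
    funext j
    have := congrFun h (σ j)
    by_cases h0 : 0 < a (σ j) <;> simpa [h0] using this

theorem lower (a : Fin 7 → ℝ) (ha : ∀ i, a i ≠ 0) :
    prob 7 (fun s => |∑ i, a i * rsign (s i)| > Real.sqrt (∑ i, (a i) ^ 2)) ≥ 7 / 32 := by
  have h1 := count_one a ha
  have h2 : 28 ≤ (univ.filter fun s : Fin 7 → Bool =>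
      |∑ i, a i * rsign (s i)| > Real.sqrt (∑ i, (a i) ^ 2)).card := by
    set N := Real.sqrt (∑ i, (a i) ^ 2) with hN
    have hN0 : 0 ≤ N := Real.sqrt_nonneg _
    have h3 : 14 ≤ (univ.filter fun s => S a s < -N).card := by
      refine h1.trans (Finset.card_le_card_of_injOn (fun s i => !s i) ?_ ?_)
      · intro s h
        simp only [coe_filter, mem_univ, true_and, Set.mem_ofPred_eq] at h ⊢
        rw [S_neg]
        linarith
      · intro s _ t _ h
        funext j
        simpa using congrFun h j
    have hd : Disjoint (univ.filter fun s => N < S a s) (univ.filter fun s => S a s < -N) := by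
      rw [Finset.disjoint_filter]
      intro s _ h k
      linarith
    have hc := Finset.card_union_of_disjoint hd
    refine le_trans (by rw [hc]; omega) (card_le_card (s := (univ.filter fun s => N < S a s) ∪
      (univ.filter fun s => S a s < -N)) ?_)
    intro s h
    simp only [mem_union, mem_filter, mem_univ, true_and] at h ⊢
    change N < |S a s|
    rw [lt_abs]
    rcases h with h | h
    · exact Or.inl h
    · exact Or.inr (by linarith)
  unfold prob
  rw [ge_iff_le, le_div_iff₀ (by norm_num)]
  norm_num
  exact_mod_cast h2

theorem equality : prob 7 (fun s => |∑ i, (![2, 2, 2, 1, 1, 1, 1] : Fin 7 → ℝ) i * rsign (s i)|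
    > Real.sqrt (∑ i, ((![2, 2, 2, 1, 1, 1, 1] : Fin 7 → ℝ) i) ^ 2)) = 7 / 32 := by
  have hn : Real.sqrt (∑ i, ((![2, 2, 2, 1, 1, 1, 1] : Fin 7 → ℝ) i) ^ 2) = 4 := by
    rw [Real.sqrt_eq_iff_mul_self_eq_of_pos (by norm_num)]
    simp [Fin.sum_univ_seven]
    norm_num
  have hc : (univ.filter fun s : Fin 7 → Bool =>
      4 < |2 * sg (s 0) + 2 * sg (s 1) + 2 * sg (s 2) + sg (s 3) + sg (s 4) + sg (s 5)
        + sg (s 6)|).card = 28 := by decide +kernel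
  have he : (univ.filter fun s : Fin 7 → Bool =>
      |∑ i, (![2, 2, 2, 1, 1, 1, 1] : Fin 7 → ℝ) i * rsign (s i)| > 4).card = 28 := by
    rw [← hc]
    congr 1
    ext s
    simp only [mem_filter, mem_univ, true_and, Fin.sum_univ_seven, ← sg_cast]
    rw [← Int.cast_lt (R := ℝ)]
    simp
  rw [hn]
  unfold prob
  have hcast := congrArg (Nat.cast : ℕ → ℝ) he
  rw [div_eq_iff (by norm_num)]
  norm_num at hcast ⊢
  exact hcast

theorem stmt_15 :
    (∀ a : Fin 7 → ℝ, (∀ i, a i ≠ 0) →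
        prob 7 (fun s => |∑ i, a i * rsign (s i)| > Real.sqrt (∑ i, (a i) ^ 2)) ≥ 7 / 32) ∧
    prob 7 (fun s => |∑ i, (![2, 2, 2, 1, 1, 1, 1] : Fin 7 → ℝ) i * rsign (s i)|
        > Real.sqrt (∑ i, ((![2, 2, 2, 1, 1, 1, 1] : Fin 7 → ℝ) i) ^ 2)) = 7 / 32 ∧
    sInf {p : ℝ | ∃ a : Fin 7 → ℝ, (∀ i, a i ≠ 0) ∧
        p = prob 7 (fun s => |∑ i, a i * rsign (s i)| > Real.sqrt (∑ i, (a i) ^ 2))}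
      = 7 / 32 := by
  refine ⟨lower, equality, IsLeast.csInf_eq ⟨⟨![2, 2, 2, 1, 1, 1, 1], ?_, equality.symm⟩, ?_⟩⟩
  · intro i
    fin_cases i <;> simp
  · rintro p ⟨a, ha, rfl⟩
    exact lower a ha
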